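/- For every integer e ≥ 3, let Γ be the additive submonoid of ℕ generated by the e+1 integers {e+6, e+7, e+9, e+10} ∪ {e+15, e+16, ..., 2e+11}. Then Γ is a numerical monoid with multiplicity e+6 and embedding dimension e+1 (the listed integers are its minimal generators), and ρ(Γ) = binom(e+1, 2) + 2. -/

import Mathlib

open scoped Pointwise

/-- A numerical monoid: an additive submonoid of ℕ with finite complement. -/
def IsNumericalMonoid (Γ : AddSubmonoid ℕ) : Prop :=
  ((Γ : Set ℕ)ᶜ).Finite

/-- The (unique) minimal generating set of a submonoid of ℕ: the nonzero elements
that are not sums of two nonzero elements. -/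
def minGens (Γ : AddSubmonoid ℕ) : Set ℕ :=
  {g | g ∈ Γ ∧ g ≠ 0 ∧ ∀ a ∈ Γ, ∀ b ∈ Γ, a ≠ 0 → b ≠ 0 → g ≠ a + b}

/-- Embedding dimension: the number of minimal generators. -/
noncomputable def edim (Γ : AddSubmonoid ℕ) : ℕ :=
  (minGens Γ).ncard

/-- Multiplicity: the smallest nonzero element. -/
noncomputable def mult (Γ : AddSubmonoid ℕ) : ℕ :=
  sInf {g : ℕ | g ∈ Γ ∧ g ≠ 0}

/-- The factorization homomorphism φ, sending a formal ℕ-combination of the minimal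
generators to its value in ℕ. -/
noncomputable def factorizationHom (Γ : AddSubmonoid ℕ) : (minGens Γ →₀ ℕ) →+ ℕ :=
  Finsupp.liftAddHom fun g => AddMonoidHom.mulLeft (g : ℕ)

/-- The number of minimal relations ρ(Γ): the least cardinality of a set of pairs
generating the kernel congruence of the factorization homomorphism. -/
noncomputable def rho (Γ : AddSubmonoid ℕ) : ℕ :=
  sInf {n : ℕ | ∃ R : Set ((minGens Γ →₀ ℕ) × (minGens Γ →₀ ℕ)),
    R.Finite ∧ R.ncard = n ∧
    addConGen (fun a b => (a, b) ∈ R) = AddCon.ker (factorizationHom Γ)}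

/-- Pseudo-Frobenius numbers of Γ. -/
def pseudoFrobenius (Γ : AddSubmonoid ℕ) : Set ℕ :=
  {p | p ∉ Γ ∧ ∀ g ∈ Γ, g ≠ 0 → p + g ∈ Γ}

/-- The type of Γ: the number of pseudo-Frobenius numbers. -/
noncomputable def numType (Γ : AddSubmonoid ℕ) : ℕ :=
  (pseudoFrobenius Γ).ncard

/-- The Apéry set of Γ with respect to its multiplicity. -/
def aperySet (Γ : AddSubmonoid ℕ) : Set ℕ :=
  {g | g ∈ Γ ∧ ¬ ∃ γ ∈ Γ, g = γ + mult Γ}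

/-- The Macaulay upper function: if `n = C(n_d,d) + ⋯ + C(n_j,j)` is the Macaulay
expansion of `n`, then `macUpper d n = C(n_d+1,d+1) + ⋯ + C(n_j+1,j+1)`, i.e. `n^⟨d⟩`. -/
noncomputable def macUpper : ℕ → ℕ → ℕ
  | 0, _ => 0
  | d + 1, n =>
    if n = 0 then 0
    else
      Nat.choose (sSup {a : ℕ | Nat.choose a (d + 1) ≤ n} + 1) (d + 2) +
        macUpper d (n - Nat.choose (sSup {a : ℕ | Nat.choose a (d + 1) ≤ n}) (d + 1))

/-- The Macaulay lower function: if `n = C(n_d,d) + ⋯ + C(n_j,j)` is the Macaulay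
expansion of `n`, then `macLower d n = C(n_d-1,d) + ⋯ + C(n_j-1,j)`, i.e. `n_⟨d⟩`. -/
noncomputable def macLower : ℕ → ℕ → ℕ
  | 0, _ => 0
  | d + 1, n =>
    if n = 0 then 0
    else
      Nat.choose (sSup {a : ℕ | Nat.choose a (d + 1) ≤ n} - 1) (d + 1) +
        macLower d (n - Nat.choose (sSup {a : ℕ | Nat.choose a (d + 1) ≤ n}) (d + 1))

/-- The unique positive `r` with `C(e+r-1,r-1) ≤ m < C(e+r,r)`. -/
noncomputable def macR (e m : ℕ) : ℕ :=
  sInf {r : ℕ | 0 < r ∧ m < Nat.choose (e + r) r}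

/-- The bound 𝒞(e,m) = C(e+r-1,r) + s^⟨r⟩ - s, where s = m - C(e+r-1,r-1). -/
noncomputable def mathcalC (e m : ℕ) : ℕ :=
  Nat.choose (e + macR e m - 1) (macR e m) +
      macUpper (macR e m) (m - Nat.choose (e + macR e m - 1) (macR e m - 1)) -
    (m - Nat.choose (e + macR e m - 1) (macR e m - 1))

/-- The bound 𝒟(e,m) = C(e+r-2,r-1) + s_⟨r⟩, where s = m - C(e+r-1,r-1). -/
noncomputable def mathcalD (e m : ℕ) : ℕ :=
  Nat.choose (e + macR e m - 2) (macR e m - 1) +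
    macLower (macR e m) (m - Nat.choose (e + macR e m - 1) (macR e m - 1))

/-- Lower bound: monomials all of whose proper divisors factor uniquely each cost a relation. -/
theorem card_le_ncard_of_addConGen_eq_ker {α : Type*} (φ : (α →₀ ℕ) →+ ℕ)
    (M : Finset (α →₀ ℕ))
    (hdiv : ∀ μ ∈ M, ∀ a b c, a + c = μ → c ≠ 0 → φ a = φ b → a = b)
    (hout : ∀ μ ∈ M, ∃ ν, ν ∉ M ∧ φ μ = φ ν)
    (R : Set ((α →₀ ℕ) × (α →₀ ℕ))) (hR : R.Finite)
    (hgen : addConGen (fun a b => (a, b) ∈ R) = AddCon.ker φ) :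
    M.card ≤ R.ncard := by
  classical
  let T : (α →₀ ℕ) → (M → ℚ) := fun a μ => if a = μ then 1 else 0
  have hT0 : ∀ a, a ∉ M → T a = 0 := by
    intro a ha
    funext μ
    have : a ≠ μ := fun h => ha (h ▸ μ.2)
    simp [T, this]
  let s : Finset (M → ℚ) := hR.toFinset.image fun p => T p.1 - T p.2
  let W : Submodule ℚ (M → ℚ) := Submodule.span ℚ (s : Set (M → ℚ))
  let c : AddCon (α →₀ ℕ) :=
    { r := fun a b => φ a = φ b ∧ T a - T b ∈ W
      iseqv :=
        { refl := fun a => ⟨rfl, by simp⟩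
          symm := fun {a b} h => ⟨h.1.symm, by simpa using W.neg_mem h.2⟩
          trans := fun {a b d} h h' => ⟨h.1.trans h'.1, by simpa using W.add_mem h.2 h'.2⟩ }
      add' := by
        have key : ∀ a b d, φ a = φ b → T a - T b ∈ W → T (a + d) - T (b + d) ∈ W := by
          intro a b d h hW
          by_cases hd : d = 0
          · simpa [hd] using hW
          by_cases hab : a = b
          · simp [hab]
          rw [hT0 (a + d) fun hm => hab (hdiv _ hm a b d rfl hd h),
            hT0 (b + d) fun hm => hab (hdiv _ hm b a d rfl hd h.symm).symm]
          simp
        rintro a b x y ⟨h1, h2⟩ ⟨h3, h4⟩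
        refine ⟨by simp [h1, h3], ?_⟩
        have k1 := key a b x h1 h2
        have k2 := key x y b h3 h4
        rw [add_comm x, add_comm y] at k2
        simpa using W.add_mem k1 k2 }
  have hle : AddCon.ker φ ≤ c := by
    rw [← hgen, AddCon.addConGen_le]
    intro a b hab
    refine ⟨?_, Submodule.subset_span ?_⟩
    · have : addConGen (fun a b => (a, b) ∈ R) a b := AddConGen.Rel.of _ _ hab
      rw [hgen] at this
      exact this
    · exact Finset.mem_coe.2 (Finset.mem_image.2 ⟨(a, b), by simpa using hab, rfl⟩)
  have htop : W = ⊤ := by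
    rw [eq_top_iff, ← (Pi.basisFun ℚ M).span_eq, Submodule.span_le]
    rintro _ ⟨μ, rfl⟩
    obtain ⟨ν, hν, h⟩ := hout μ μ.2
    have h2 : T μ - T ν ∈ W := (hle (show AddCon.ker φ μ ν from h)).2
    rw [hT0 ν hν, sub_zero] at h2
    have hμ : Pi.basisFun ℚ M μ = T μ := by
      funext i
      simp only [Pi.basisFun_apply, Pi.single_apply, T, Subtype.ext_iff, eq_comm (a := (i : α →₀ ℕ))]
    exact hμ ▸ h2
  have h1 : Module.finrank ℚ W ≤ s.card := finrank_span_finset_le_card s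
  rw [htop, finrank_top, Module.finrank_fintype_fun_eq_card, Fintype.card_coe] at h1
  rw [Set.ncard_eq_toFinset_card R hR]
  exact h1.trans Finset.card_image_le

theorem exists_eq_single_add {α : Type*} (a : α →₀ ℕ) (x : α) (h : a x ≠ 0) :
    ∃ b, a = Finsupp.single x 1 + b := by
  classical
  refine ⟨a - Finsupp.single x 1, ?_⟩
  ext y
  rcases eq_or_ne x y with rfl | hxy
  · simp; omega
  · simp [hxy]

/-- Upper bound: rewriting each monomial of `M` to one divisible by `p` generates the kernel, as
soon as a monomial prime to `p` factors uniquely or is divisible by a monomial of `M`. -/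
theorem addConGen_eq_ker_of_rewriting {α : Type*} (φ : (α →₀ ℕ) →+ ℕ) (p : α)
    (hp : φ (Finsupp.single p 1) ≠ 0) (M : Set (α →₀ ℕ)) (ν : (α →₀ ℕ) → (α →₀ ℕ))
    (hν : ∀ μ ∈ M, ν μ p ≠ 0 ∧ φ μ = φ (ν μ))
    (hM : ∀ a : α →₀ ℕ, a p = 0 → (∃ μ ∈ M, ∃ c, a = μ + c) ∨ ∀ b, φ a = φ b → a = b) :
    addConGen (fun a b => (a, b) ∈ (fun μ => (μ, ν μ)) '' M) = AddCon.ker φ := by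
  apply le_antisymm
  · rw [AddCon.addConGen_le]
    rintro a b ⟨μ, hμ, h⟩
    obtain ⟨rfl, rfl⟩ := Prod.ext_iff.1 h
    exact (hν _ hμ).2
  set C := addConGen (fun a b => (a, b) ∈ (fun μ => (μ, ν μ)) '' M) with hC
  have hCφ : ∀ μ ∈ M, C μ (ν μ) := fun μ hμ => AddConGen.Rel.of _ _ ⟨μ, hμ, rfl⟩
  have red : ∀ a : α →₀ ℕ,
      (∃ a', C a a' ∧ φ a = φ a' ∧ a' p ≠ 0) ∨ ∀ b, φ a = φ b → a = b := by
    intro a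
    by_cases h : a p = 0
    · rcases hM a h with ⟨μ, hμ, c, rfl⟩ | h
      · refine Or.inl ⟨ν μ + c, C.add (hCφ μ hμ) (C.refl c), ?_, ?_⟩
        · simp [(hν μ hμ).2]
        · have := (hν μ hμ).1
          simp only [Finsupp.add_apply]
          omega
      · exact Or.inr h
    · exact Or.inl ⟨a, C.refl a, rfl, h⟩
  have main : ∀ n, ∀ a b, φ a = n → φ b = n → C a b := by
    intro n
    induction n using Nat.strong_induction_on with
    | _ n ih =>
      intro a b ha hb
      rcases red a with ⟨a', haC, haφ, hap⟩ | h
      · rcases red b with ⟨b', hbC, hbφ, hbp⟩ | h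
        · obtain ⟨a'', rfl⟩ := exists_eq_single_add a' p hap
          obtain ⟨b'', rfl⟩ := exists_eq_single_add b' p hbp
          rw [map_add] at haφ hbφ
          have := ih (φ a'') (by omega) a'' b'' rfl (by omega)
          exact C.trans haC (C.trans (C.add (C.refl _) this) (C.symm hbC))
        · rw [h a (hb.trans ha.symm)]
          exact C.refl _
      · rw [h b (ha.trans hb.symm)]
        exact C.refl _
  intro a b hab
  exact main _ a b rfl (show φ a = φ b from hab).symm

/-- The monomials whose rewriting rules present the monoid: all quadrics prime to `p0` but five,
and seven cubics. -/
theorem exists_finset_leading_monomials {α : Type*} [Fintype α] [DecidableEq α] {p0 p1 p3 p4 : α}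
    (h01 : p0 ≠ p1) (h03 : p0 ≠ p3) (h04 : p0 ≠ p4) (h13 : p1 ≠ p3) (h14 : p1 ≠ p4)
    (h34 : p3 ≠ p4) :
    ∃ M : Finset (α →₀ ℕ), M.card = (Fintype.card α).choose 2 + 2 ∧ ∀ a, a ∈ M ↔
      (∃ x y, x ≠ p0 ∧ y ≠ p0 ∧
        s(x, y) ∉ ({s(p1, p1), s(p1, p4), s(p3, p3), s(p3, p4), s(p4, p4)} : Finset (Sym2 α)) ∧
        a = Finsupp.single x 1 + Finsupp.single y 1) ∨
      ∃ x y z, ((x = p1 ∧ y = p1 ∧ z = p1) ∨ (x = p1 ∧ y = p1 ∧ z = p4) ∨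
          (x = p1 ∧ y = p4 ∧ z = p4) ∨ (x = p4 ∧ y = p4 ∧ z = p4) ∨
          (x = p3 ∧ y = p3 ∧ z = p3) ∨ (x = p3 ∧ y = p3 ∧ z = p4) ∨
          (x = p3 ∧ y = p4 ∧ z = p4)) ∧
        a = Finsupp.single x 1 + (Finsupp.single y 1 + Finsupp.single z 1) := by
  let f : Sym2 α → (α →₀ ℕ) := Sym2.lift
    ⟨fun x y => Finsupp.single x 1 + Finsupp.single y 1, fun x y => add_comm _ _⟩
  have hf : Function.Injective f := by
    intro u v
    induction u using Sym2.ind with | _ x y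
    induction v using Sym2.ind with | _ z w
    intro h
    have h' : Finsupp.single x 1 + Finsupp.single y 1 =
      (Finsupp.single z 1 + Finsupp.single w 1 : α →₀ ℕ) := h
    rw [Finsupp.single_add_single_eq_single_add_single one_ne_zero one_ne_zero] at h'
    rw [Sym2.eq_iff]
    rcases h' with h | ⟨-, h⟩ | ⟨h, -⟩
    · exact Or.inl h
    · exact Or.inr h
    · omega
  let g : ℕ × ℕ × ℕ → (α →₀ ℕ) := fun t =>
    Finsupp.single p1 t.1 + Finsupp.single p3 t.2.1 + Finsupp.single p4 t.2.2
  have hg : Function.Injective g := by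
    rintro ⟨i, j, k⟩ ⟨i', j', k'⟩ h
    have e1 := DFunLike.congr_fun h p1
    have e3 := DFunLike.congr_fun h p3
    have e4 := DFunLike.congr_fun h p4
    simp [g, h13, h14, h34, h13.symm, h14.symm, h34.symm] at e1 e3 e4
    simp [e1, e3, e4]
  let E : Finset (Sym2 α) := {s(p1, p1), s(p1, p4), s(p3, p3), s(p3, p4), s(p4, p4)}
  let Q : Finset (Sym2 α) := (Finset.univ.erase p0).sym2
  let K : Finset (ℕ × ℕ × ℕ) :=
    {(3, 0, 0), (2, 0, 1), (1, 0, 2), (0, 0, 3), (0, 3, 0), (0, 2, 1), (0, 1, 2)}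
  have hE : E.card = 5 := by
    simp [E, Finset.card_insert_of_notMem, h13, h14, h34, h34.symm]
  have hEQ : E ⊆ Q := by
    intro u hu
    simp only [E, Finset.mem_insert, Finset.mem_singleton] at hu
    rcases hu with rfl | rfl | rfl | rfl | rfl <;>
      simp [Q, h01.symm, h03.symm, h04.symm]
  have hpos : Fintype.card α - 1 + 1 = Fintype.card α :=
    Nat.sub_add_cancel (Fintype.card_pos_iff.2 ⟨p0⟩)
  have hQ : Q.card = (Fintype.card α).choose 2 := by
    simp [Q, Finset.card_sym2, Finset.card_erase_of_mem, hpos]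
  have hK : K.card = 7 := by decide
  have hdisj : Disjoint ((Q \ E).image f) (K.image g) := by
    rw [Finset.disjoint_left]
    intro a ha ha'
    obtain ⟨u, -, rfl⟩ := Finset.mem_image.1 ha
    obtain ⟨t, ht, h⟩ := Finset.mem_image.1 ha'
    induction u using Sym2.ind with | _ x y
    have h' := congrArg Finsupp.degree h
    have hl : Finsupp.degree (f s(x, y)) = 2 := by simp [f]
    rw [hl] at h'
    simp only [g, map_add, Finsupp.degree_single] at h'
    simp only [K, Finset.mem_insert, Finset.mem_singleton] at ht
    rcases ht with rfl | rfl | rfl | rfl | rfl | rfl | rfl <;> simp at h'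
  refine ⟨(Q \ E).image f ∪ K.image g, ?_, ?_⟩
  · rw [Finset.card_union_of_disjoint hdisj, Finset.card_image_of_injective _ hf,
      Finset.card_image_of_injective _ hg, Finset.card_sdiff_of_subset hEQ, hE, hQ, hK]
    have := Finset.card_le_card hEQ
    omega
  · intro a
    rw [Finset.mem_union]
    apply or_congr
    · constructor
      · intro h
        obtain ⟨u, hu, rfl⟩ := Finset.mem_image.1 h
        induction u using Sym2.ind with | _ x y
        rw [Finset.mem_sdiff] at hu
        have := hu.1
        simp only [Q, Finset.mk_mem_sym2_iff, Finset.mem_erase, Finset.mem_univ, and_true] at this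
        exact ⟨x, y, this.1, this.2, hu.2, rfl⟩
      · rintro ⟨x, y, hx, hy, hxy, rfl⟩
        refine Finset.mem_image.2 ⟨s(x, y), Finset.mem_sdiff.2 ⟨?_, hxy⟩, rfl⟩
        simp [Q, hx, hy]
    · have two : ∀ x : α, (Finsupp.single x 2 : α →₀ ℕ) =
          Finsupp.single x 1 + Finsupp.single x 1 := fun x => by rw [← Finsupp.single_add]
      have three : ∀ x : α, (Finsupp.single x 3 : α →₀ ℕ) =
          Finsupp.single x 1 + (Finsupp.single x 1 + Finsupp.single x 1) := fun x => by
        rw [← Finsupp.single_add, ← Finsupp.single_add]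
        rfl
      simp only [K, Finset.image_insert, Finset.image_singleton, Finset.mem_insert,
        Finset.mem_singleton, g, two, three, Finsupp.single_zero, zero_add, add_zero, add_assoc]
      constructor
      · rintro (h | h | h | h | h | h | h) <;>
          exact ⟨_, _, _, by simp, h⟩
      · rintro ⟨x, y, z, (⟨rfl, rfl, rfl⟩ | ⟨rfl, rfl, rfl⟩ | ⟨rfl, rfl, rfl⟩ | ⟨rfl, rfl, rfl⟩ |
          ⟨rfl, rfl, rfl⟩ | ⟨rfl, rfl, rfl⟩ | ⟨rfl, rfl, rfl⟩), h⟩ <;> simp [h]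

/-- Values of the generators of a monoid of multiplicity `m` with generators
`m, m + 1, m + 3, m + 4, m + 9, …, 2 * m - 1`. -/
structure HasDelta6Values {α : Type*} (φ : (α →₀ ℕ) →+ ℕ) (m : ℕ) (p0 p1 p3 p4 : α) : Prop where
  nine_le : 9 ≤ m
  val0 : φ (Finsupp.single p0 1) = m
  val1 : φ (Finsupp.single p1 1) = m + 1
  val3 : φ (Finsupp.single p3 1) = m + 3
  val4 : φ (Finsupp.single p4 1) = m + 4
  inj : ∀ x y, φ (Finsupp.single x 1) = φ (Finsupp.single y 1) → x = y
  mem : ∀ x, φ (Finsupp.single x 1) = m ∨ φ (Finsupp.single x 1) = m + 1 ∨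
    φ (Finsupp.single x 1) = m + 3 ∨ φ (Finsupp.single x 1) = m + 4 ∨
    m + 9 ≤ φ (Finsupp.single x 1)
  lt : ∀ x, φ (Finsupp.single x 1) < 2 * m
  surj : ∀ t, (t = m ∨ t = m + 1 ∨ t = m + 3 ∨ t = m + 4 ∨ m + 9 ≤ t) → ∃ b, φ b = t

theorem eq_zero_or_exists_single_add {α : Type*} (a : α →₀ ℕ) :
    a = 0 ∨ ∃ x b, a = Finsupp.single x 1 + b := by
  by_cases h : a = 0
  · exact Or.inl h
  · obtain ⟨x, hx⟩ := Finsupp.ne_iff.1 h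
    exact Or.inr ⟨x, exists_eq_single_add a x hx⟩

/-- A monomial dividing a product of two variables properly divides one of them. -/
theorem exists_single_eq_add_of_add_eq_pair {α : Type*} {a c : α →₀ ℕ} {x y : α}
    (h : a + c = Finsupp.single x 1 + Finsupp.single y 1) (hc : c ≠ 0) :
    ∃ z d, a + d = Finsupp.single z 1 := by
  classical
  rcases eq_zero_or_exists_single_add c with rfl | ⟨w, d, rfl⟩
  · exact absurd rfl hc
  have hw := DFunLike.congr_fun h w
  by_cases hx : x = w
  · refine ⟨y, d, ?_⟩
    subst hx
    apply add_left_cancel (a := Finsupp.single x 1)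
    rw [← h]
    abel
  by_cases hy : y = w
  · refine ⟨x, d, ?_⟩
    subst hy
    apply add_right_cancel (b := Finsupp.single y 1)
    rw [← h]
    abel
  · simp [hx, hy] at hw

/-- A monomial dividing a product of three variables properly divides a product of two. -/
theorem exists_pair_eq_add_of_add_eq_triple {α : Type*} {a c : α →₀ ℕ} {x y z : α}
    (h : a + c = Finsupp.single x 1 + (Finsupp.single y 1 + Finsupp.single z 1)) (hc : c ≠ 0) :
    ∃ d, a + d = Finsupp.single y 1 + Finsupp.single z 1 ∨
      a + d = Finsupp.single x 1 + Finsupp.single z 1 ∨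
      a + d = Finsupp.single x 1 + Finsupp.single y 1 := by
  classical
  rcases eq_zero_or_exists_single_add c with rfl | ⟨w, d, rfl⟩
  · exact absurd rfl hc
  have hw := DFunLike.congr_fun h w
  refine ⟨d, ?_⟩
  by_cases hx : x = w
  · left
    subst hx
    apply add_left_cancel (a := Finsupp.single x 1)
    rw [← h]
    abel
  by_cases hy : y = w
  · right; left
    subst hy
    apply add_left_cancel (a := Finsupp.single y 1)
    rw [add_left_comm _ (Finsupp.single x 1), ← h]
    abel
  by_cases hz : z = w
  · right; right
    subst hz
    apply add_right_cancel (b := Finsupp.single z 1)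
    rw [add_assoc (Finsupp.single x 1), ← h]
    abel
  · simp [hx, hy, hz] at hw

/-- Three variables whose pairwise products are among the five exceptional quadrics have one of
the seven exceptional cubics as product. -/
theorem exists_sorted_triple {α : Type*} [DecidableEq α] {p1 p3 p4 x y z : α}
    (h13 : p1 ≠ p3) (h14 : p1 ≠ p4) (h34 : p3 ≠ p4)
    (hxy : s(x, y) ∈ ({s(p1, p1), s(p1, p4), s(p3, p3), s(p3, p4), s(p4, p4)} : Finset (Sym2 α)))
    (hxz : s(x, z) ∈ ({s(p1, p1), s(p1, p4), s(p3, p3), s(p3, p4), s(p4, p4)} : Finset (Sym2 α)))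
    (hyz : s(y, z) ∈ ({s(p1, p1), s(p1, p4), s(p3, p3), s(p3, p4), s(p4, p4)} : Finset (Sym2 α))) :
    ∃ u v w, ((u = p1 ∧ v = p1 ∧ w = p1) ∨ (u = p1 ∧ v = p1 ∧ w = p4) ∨
        (u = p1 ∧ v = p4 ∧ w = p4) ∨ (u = p4 ∧ v = p4 ∧ w = p4) ∨
        (u = p3 ∧ v = p3 ∧ w = p3) ∨ (u = p3 ∧ v = p3 ∧ w = p4) ∨
        (u = p3 ∧ v = p4 ∧ w = p4)) ∧
      Finsupp.single x 1 + (Finsupp.single y 1 + Finsupp.single z 1) =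
        (Finsupp.single u 1 + (Finsupp.single v 1 + Finsupp.single w 1) : α →₀ ℕ) := by
  have var_cases : ∀ {x y : α},
      s(x, y) ∈ ({s(p1, p1), s(p1, p4), s(p3, p3), s(p3, p4), s(p4, p4)} : Finset (Sym2 α)) →
      (x = p1 ∨ x = p3 ∨ x = p4) ∧ (y = p1 ∨ y = p3 ∨ y = p4) := by
    intro x y h
    simp only [Finset.mem_insert, Finset.mem_singleton, Sym2.eq_iff] at h
    rcases h with ((⟨rfl, rfl⟩ | ⟨rfl, rfl⟩) | (⟨rfl, rfl⟩ | ⟨rfl, rfl⟩) |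
      (⟨rfl, rfl⟩ | ⟨rfl, rfl⟩) | (⟨rfl, rfl⟩ | ⟨rfl, rfl⟩) | ⟨rfl, rfl⟩ | ⟨rfl, rfl⟩) <;> simp
  obtain ⟨hx, hy⟩ := var_cases hxy
  have hz := (var_cases hxz).2
  rcases hx with hx | hx | hx <;> rcases hy with hy | hy | hy <;>
    rcases hz with hz | hz | hz <;>
    first
      | refine ⟨x, y, z, ?_, rfl⟩; simp [hx, hy, hz]; done
      | refine ⟨x, z, y, ?_, by abel⟩; simp [hx, hy, hz]; done
      | refine ⟨y, x, z, ?_, by abel⟩; simp [hx, hy, hz]; done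
      | refine ⟨y, z, x, ?_, by abel⟩; simp [hx, hy, hz]; done
      | refine ⟨z, x, y, ?_, by abel⟩; simp [hx, hy, hz]; done
      | refine ⟨z, y, x, ?_, by abel⟩; simp [hx, hy, hz]; done
      | simp [hx, hy, h13, h14, h34, h13.symm, h34.symm] at hxy; done
      | simp [hx, hz, h13, h14, h34, h13.symm, h34.symm] at hxz; done
      | simp [hy, hz, h13, h14, h34, h13.symm] at hyz

theorem eq_of_add_factors_uniquely {α : Type*} (φ : (α →₀ ℕ) →+ ℕ) {a d : α →₀ ℕ}
    (h : ∀ b, φ (a + d) = φ b → a + d = b) : ∀ b, φ a = φ b → a = b := by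
  intro b hb
  exact add_right_cancel (h (b + d) (by simp [hb]))

namespace HasDelta6Values

variable {α : Type*} {φ : (α →₀ ℕ) →+ ℕ} {m : ℕ} {p0 p1 p3 p4 : α}

theorem le (H : HasDelta6Values φ m p0 p1 p3 p4) (x : α) : m ≤ φ (Finsupp.single x 1) := by
  have := H.mem x
  omega

/-- A monomial of value less than `3 * m` has degree at most two. -/
theorem cases_of_lt (H : HasDelta6Values φ m p0 p1 p3 p4) (b : α →₀ ℕ) (hb : φ b < 3 * m) :
    b = 0 ∨ (∃ x, b = Finsupp.single x 1) ∨
      ∃ x y, b = Finsupp.single x 1 + Finsupp.single y 1 := by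
  rcases eq_zero_or_exists_single_add b with rfl | ⟨x, b, rfl⟩
  · exact Or.inl rfl
  rcases eq_zero_or_exists_single_add b with rfl | ⟨y, b, rfl⟩
  · exact Or.inr (Or.inl ⟨x, by simp⟩)
  rcases eq_zero_or_exists_single_add b with rfl | ⟨z, b, rfl⟩
  · exact Or.inr (Or.inr ⟨x, y, by simp⟩)
  have := H.le x
  have := H.le y
  have := H.le z
  simp only [map_add] at hb
  omega

theorem zero_unique (H : HasDelta6Values φ m p0 p1 p3 p4) :
    ∀ b, φ 0 = φ b → 0 = b := by
  intro b hb
  have := H.nine_le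
  rw [map_zero] at hb
  rcases H.cases_of_lt b (by omega) with rfl | ⟨y, rfl⟩ | ⟨y, z, rfl⟩
  · rfl
  · have := H.le y
    omega
  · have := H.le y
    rw [map_add] at hb
    omega

theorem single_unique (H : HasDelta6Values φ m p0 p1 p3 p4) (x : α) :
    ∀ b, φ (Finsupp.single x 1) = φ b → Finsupp.single x 1 = b := by
  intro b hb
  have h1 := H.lt x
  have h2 := H.le x
  have := H.nine_le
  rcases H.cases_of_lt b (by omega) with rfl | ⟨y, rfl⟩ | ⟨y, z, rfl⟩
  · rw [map_zero] at hb
    omega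
  · rw [H.inj x y hb]
  · have := H.le y
    have := H.le z
    rw [map_add] at hb
    omega

theorem pair_unique (H : HasDelta6Values φ m p0 p1 p3 p4) [DecidableEq α] {x y : α}
    (hxy : s(x, y) ∈
      ({s(p1, p1), s(p1, p4), s(p3, p3), s(p3, p4), s(p4, p4)} : Finset (Sym2 α))) :
    ∀ b, φ (Finsupp.single x 1 + Finsupp.single y 1) = φ b →
      Finsupp.single x 1 + Finsupp.single y 1 = b := by
  intro b hb
  have := H.nine_le
  have v1 := H.val1
  have v3 := H.val3
  have v4 := H.val4
  simp only [Finset.mem_insert, Finset.mem_singleton, Sym2.eq_iff] at hxy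
  have hval : (φ (Finsupp.single x 1 + Finsupp.single y 1) = 2 * m + 2 ∨
      2 * m + 5 ≤ φ (Finsupp.single x 1 + Finsupp.single y 1)) ∧
      φ (Finsupp.single x 1 + Finsupp.single y 1) ≤ 2 * m + 8 := by
    rcases hxy with ((⟨rfl, rfl⟩ | ⟨rfl, rfl⟩) | (⟨rfl, rfl⟩ | ⟨rfl, rfl⟩) |
      (⟨rfl, rfl⟩ | ⟨rfl, rfl⟩) | (⟨rfl, rfl⟩ | ⟨rfl, rfl⟩) | ⟨rfl, rfl⟩ | ⟨rfl, rfl⟩) <;>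
    · rw [map_add]
      omega
  rcases H.cases_of_lt b (by omega) with rfl | ⟨z, rfl⟩ | ⟨z, w, rfl⟩
  · rw [map_zero] at hb
    omega
  · have := H.lt z
    omega
  · rw [map_add, map_add] at hb
    rw [map_add] at hval
    have hz := H.mem z
    have hw := H.mem w
    have key : (x = z ∧ y = w) ∨ (x = w ∧ y = z) := by
      suffices h : (φ (Finsupp.single x 1) = φ (Finsupp.single z 1) ∧
          φ (Finsupp.single y 1) = φ (Finsupp.single w 1)) ∨
          (φ (Finsupp.single x 1) = φ (Finsupp.single w 1) ∧
          φ (Finsupp.single y 1) = φ (Finsupp.single z 1)) from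
        h.imp (fun h => ⟨H.inj _ _ h.1, H.inj _ _ h.2⟩) (fun h => ⟨H.inj _ _ h.1, H.inj _ _ h.2⟩)
      rcases hxy with ((⟨rfl, rfl⟩ | ⟨rfl, rfl⟩) | (⟨rfl, rfl⟩ | ⟨rfl, rfl⟩) |
        (⟨rfl, rfl⟩ | ⟨rfl, rfl⟩) | (⟨rfl, rfl⟩ | ⟨rfl, rfl⟩) | ⟨rfl, rfl⟩ | ⟨rfl, rfl⟩) <;>
      omega
    rcases key with ⟨rfl, rfl⟩ | ⟨rfl, rfl⟩
    · rfl
    · exact add_comm _ _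

/-- A monomial of value `m + t`, with `t` in the monoid, is equivalent to one divisible by
`p0`. -/
theorem exists_rewriting (H : HasDelta6Values φ m p0 p1 p3 p4) {a : α →₀ ℕ}
    (h : φ a = 2 * m ∨ φ a = 2 * m + 1 ∨ φ a = 2 * m + 3 ∨ φ a = 2 * m + 4 ∨
      2 * m + 9 ≤ φ a) : ∃ ν : α →₀ ℕ, ν p0 ≠ 0 ∧ φ a = φ ν := by
  obtain ⟨b, hb⟩ := H.surj (φ a - m) (by omega)
  refine ⟨Finsupp.single p0 1 + b, by simp, ?_⟩
  rw [map_add, H.val0, hb]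
  omega

/-- The leading monomials of the monoid, with the properties that make their rewriting rules a
minimal presentation. -/
theorem exists_leading_monomials [Fintype α] (H : HasDelta6Values φ m p0 p1 p3 p4) :
    ∃ M : Finset (α →₀ ℕ), M.card = (Fintype.card α).choose 2 + 2 ∧
      (∀ μ ∈ M, μ p0 = 0) ∧
      (∀ μ ∈ M, ∃ ν : α →₀ ℕ, ν p0 ≠ 0 ∧ φ μ = φ ν) ∧
      (∀ μ ∈ M, ∀ a b c, a + c = μ → c ≠ 0 → φ a = φ b → a = b) ∧
      ∀ a : α →₀ ℕ, a p0 = 0 → (∃ μ ∈ M, ∃ c, a = μ + c) ∨ ∀ b, φ a = φ b → a = b := by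
  classical
  have v0 := H.val0
  have v1 := H.val1
  have v3 := H.val3
  have v4 := H.val4
  have h9 := H.nine_le
  have ne : ∀ x y, φ (Finsupp.single x 1) ≠ φ (Finsupp.single y 1) → x ≠ y := by
    rintro x y h rfl
    exact h rfl
  have h01 : p0 ≠ p1 := ne _ _ (by omega)
  have h03 : p0 ≠ p3 := ne _ _ (by omega)
  have h04 : p0 ≠ p4 := ne _ _ (by omega)
  have h13 : p1 ≠ p3 := ne _ _ (by omega)
  have h14 : p1 ≠ p4 := ne _ _ (by omega)
  have h34 : p3 ≠ p4 := ne _ _ (by omega)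
  obtain ⟨M, hcard, hM⟩ := exists_finset_leading_monomials h01 h03 h04 h13 h14 h34
  refine ⟨M, hcard, ?_, ?_, ?_, ?_⟩
  · intro μ hμ
    rcases (hM μ).1 hμ with ⟨x, y, hx, hy, -, rfl⟩ | ⟨x, y, z, h, rfl⟩
    · simp [hx, hy]
    · rcases h with (⟨rfl, rfl, rfl⟩ | ⟨rfl, rfl, rfl⟩ | ⟨rfl, rfl, rfl⟩ | ⟨rfl, rfl, rfl⟩ |
          ⟨rfl, rfl, rfl⟩ | ⟨rfl, rfl, rfl⟩ | ⟨rfl, rfl, rfl⟩) <;>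
        simp [h01, h03, h04]
  · intro μ hμ
    apply H.exists_rewriting
    rcases (hM μ).1 hμ with ⟨x, y, hx, hy, hxy, rfl⟩ | ⟨x, y, z, h, rfl⟩
    · have mem := H.mem
      have val : ∀ x, x ≠ p0 → (x = p1 ∧ φ (Finsupp.single x 1) = m + 1) ∨
          (x = p3 ∧ φ (Finsupp.single x 1) = m + 3) ∨
          (x = p4 ∧ φ (Finsupp.single x 1) = m + 4) ∨ m + 9 ≤ φ (Finsupp.single x 1) := by
        intro x hx
        rcases mem x with h | h | h | h | h
        · exact absurd (H.inj _ _ (h.trans v0.symm)) hx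
        · exact Or.inl ⟨H.inj _ _ (h.trans v1.symm), h⟩
        · exact Or.inr (Or.inl ⟨H.inj _ _ (h.trans v3.symm), h⟩)
        · exact Or.inr (Or.inr (Or.inl ⟨H.inj _ _ (h.trans v4.symm), h⟩))
        · exact Or.inr (Or.inr (Or.inr h))
      have lx := H.le x
      have ly := H.le y
      rw [map_add]
      rcases val x hx with ⟨rfl, h⟩ | ⟨rfl, h⟩ | ⟨rfl, h⟩ | h <;>
        rcases val y hy with ⟨rfl, h'⟩ | ⟨rfl, h'⟩ | ⟨rfl, h'⟩ | h' <;>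
        first
          | omega
          | exact absurd (by simp) hxy
    · simp only [map_add]
      rcases h with (⟨rfl, rfl, rfl⟩ | ⟨rfl, rfl, rfl⟩ | ⟨rfl, rfl, rfl⟩ | ⟨rfl, rfl, rfl⟩ |
          ⟨rfl, rfl, rfl⟩ | ⟨rfl, rfl, rfl⟩ | ⟨rfl, rfl, rfl⟩) <;> omega
  · intro μ hμ a b c hac hc
    rcases (hM μ).1 hμ with ⟨x, y, hx, hy, hxy, rfl⟩ | ⟨x, y, z, h, rfl⟩
    · obtain ⟨z, d, hd⟩ := exists_single_eq_add_of_add_eq_pair hac hc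
      exact eq_of_add_factors_uniquely φ (d := d) (hd ▸ H.single_unique z) b
    · obtain ⟨d, hd⟩ := exists_pair_eq_add_of_add_eq_triple hac hc
      refine eq_of_add_factors_uniquely φ (d := d) ?_ b
      rcases hd with hd | hd | hd <;> rw [hd] <;> apply H.pair_unique <;>
        rcases h with (⟨rfl, rfl, rfl⟩ | ⟨rfl, rfl, rfl⟩ | ⟨rfl, rfl, rfl⟩ | ⟨rfl, rfl, rfl⟩ |
          ⟨rfl, rfl, rfl⟩ | ⟨rfl, rfl, rfl⟩ | ⟨rfl, rfl, rfl⟩) <;> simp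
  · intro a ha
    rcases eq_zero_or_exists_single_add a with rfl | ⟨x, b, rfl⟩
    · exact Or.inr H.zero_unique
    rcases eq_zero_or_exists_single_add b with rfl | ⟨y, b, rfl⟩
    · rw [add_zero]
      exact Or.inr (H.single_unique x)
    have ne0 : ∀ (x : α) (b : α →₀ ℕ), (Finsupp.single x 1 + b : α →₀ ℕ) p0 = 0 → x ≠ p0 ∧ b p0 = 0 := by
      intro x b h
      refine ⟨?_, ?_⟩
      · rintro rfl
        simp at h
      · rw [Finsupp.add_apply] at h
        omega
    obtain ⟨hx, ha⟩ := ne0 _ _ ha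
    obtain ⟨hy, ha⟩ := ne0 _ _ ha
    by_cases hxy : s(x, y) ∈
        ({s(p1, p1), s(p1, p4), s(p3, p3), s(p3, p4), s(p4, p4)} : Finset (Sym2 α))
    swap
    · exact Or.inl ⟨_, (hM _).2 (Or.inl ⟨x, y, hx, hy, hxy, rfl⟩), b, (add_assoc _ _ _).symm⟩
    rcases eq_zero_or_exists_single_add b with rfl | ⟨z, b, rfl⟩
    · rw [add_zero]
      exact Or.inr (H.pair_unique hxy)
    obtain ⟨hz, -⟩ := ne0 _ _ ha
    left
    by_cases hxz : s(x, z) ∈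
        ({s(p1, p1), s(p1, p4), s(p3, p3), s(p3, p4), s(p4, p4)} : Finset (Sym2 α))
    swap
    · exact ⟨_, (hM _).2 (Or.inl ⟨x, z, hx, hz, hxz, rfl⟩), Finsupp.single y 1 + b, by abel⟩
    by_cases hyz : s(y, z) ∈
        ({s(p1, p1), s(p1, p4), s(p3, p3), s(p3, p4), s(p4, p4)} : Finset (Sym2 α))
    swap
    · exact ⟨_, (hM _).2 (Or.inl ⟨y, z, hy, hz, hyz, rfl⟩), Finsupp.single x 1 + b, by abel⟩
    exact ⟨_, (hM _).2 (Or.inr (exists_sorted_triple h13 h14 h34 hxy hxz hyz)), b, by abel⟩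

end HasDelta6Values

/-- The number of relations needed to generate the kernel of `φ`. -/
theorem HasDelta6Values.sInf_ncard_eq {α : Type*} [Fintype α] {φ : (α →₀ ℕ) →+ ℕ} {m : ℕ}
    {p0 p1 p3 p4 : α} (H : HasDelta6Values φ m p0 p1 p3 p4) :
    sInf {n : ℕ | ∃ R : Set ((α →₀ ℕ) × (α →₀ ℕ)), R.Finite ∧ R.ncard = n ∧
      addConGen (fun a b => (a, b) ∈ R) = AddCon.ker φ} = (Fintype.card α).choose 2 + 2 := by
  obtain ⟨M, hcard, hM0, hν, hdiv, hfac⟩ := H.exists_leading_monomials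
  choose! ν hν using hν
  have hgen := addConGen_eq_ker_of_rewriting φ p0
    (by rw [H.val0]; have := H.nine_le; omega) (M : Set (α →₀ ℕ)) ν hν hfac
  have hinj : Function.Injective fun μ => (μ, ν μ) := fun a b h => (Prod.ext_iff.1 h).1
  have hmem : M.card ∈ {n : ℕ | ∃ R : Set ((α →₀ ℕ) × (α →₀ ℕ)), R.Finite ∧ R.ncard = n ∧
      addConGen (fun a b => (a, b) ∈ R) = AddCon.ker φ} :=
    ⟨_, M.finite_toSet.image _, by
      rw [Set.ncard_image_of_injective _ hinj, Set.ncard_coe_finset], hgen⟩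
  rw [← hcard]
  refine le_antisymm (Nat.sInf_le hmem) (le_csInf ⟨_, hmem⟩ ?_)
  rintro n ⟨R, hR, rfl, hgenR⟩
  refine card_le_ncard_of_addConGen_eq_ker φ M hdiv (fun μ hμ => ⟨ν μ, fun h => ?_, (hν μ hμ).2⟩)
    R hR hgenR
  exact (hν μ hμ).1 (hM0 _ h)

theorem mem_delta6_gens_iff (e x : ℕ) :
    x ∈ ({e + 6, e + 7, e + 9, e + 10} ∪ {x | e + 15 ≤ x ∧ x ≤ 2 * e + 11} : Set ℕ) ↔
      x = e + 6 ∨ x = e + 7 ∨ x = e + 9 ∨ x = e + 10 ∨ e + 15 ≤ x ∧ x ≤ 2 * e + 11 := by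
  simp only [Set.mem_union, Set.mem_insert_iff, Set.mem_singleton_iff, Set.mem_ofPred_eq]
  omega

theorem mem_closure_delta6_gens_iff {e : ℕ} (he : 3 ≤ e) (n : ℕ) :
    n ∈ AddSubmonoid.closure
        ({e + 6, e + 7, e + 9, e + 10} ∪ {x | e + 15 ≤ x ∧ x ≤ 2 * e + 11}) ↔
      n = 0 ∨ n = e + 6 ∨ n = e + 7 ∨ n = e + 9 ∨ n = e + 10 ∨ e + 15 ≤ n := by
  constructor
  · intro h
    induction h using AddSubmonoid.closure_induction with
    | mem x hx =>
      rw [mem_delta6_gens_iff] at hx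
      omega
    | zero => exact Or.inl rfl
    | add x y _ _ hx hy => omega
  · set Γ := AddSubmonoid.closure
        ({e + 6, e + 7, e + 9, e + 10} ∪ {x | e + 15 ≤ x ∧ x ≤ 2 * e + 11}) with hΓ
    have gen : ∀ x, (x = e + 6 ∨ x = e + 7 ∨ x = e + 9 ∨ x = e + 10 ∨
        e + 15 ≤ x ∧ x ≤ 2 * e + 11) → x ∈ Γ := fun x hx =>
      AddSubmonoid.subset_closure ((mem_delta6_gens_iff e x).2 hx)
    have sum : ∀ x y, x ∈ Γ → y ∈ Γ → ∀ z, z = x + y → z ∈ Γ := by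
      rintro x y hx hy _ rfl
      exact Γ.add_mem hx hy
    induction n using Nat.strong_induction_on with
    | _ n ih =>
      intro hn
      by_cases h0 : n = 0
      · exact h0 ▸ Γ.zero_mem
      by_cases hlt : n < 2 * e + 12
      · exact gen n (by omega)
      by_cases h : n = 2 * e + 14 ∨ 2 * e + 17 ≤ n ∧ n ≤ 2 * e + 20
      · have h7 := gen (e + 7) (by omega)
        have h9 := gen (e + 9) (by omega)
        have h10 := gen (e + 10) (by omega)
        have : n = (e + 7) + (e + 7) ∨ n = (e + 7) + (e + 10) ∨ n = (e + 9) + (e + 9) ∨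
            n = (e + 9) + (e + 10) ∨ n = (e + 10) + (e + 10) := by omega
        rcases this with h | h | h | h | h
        · exact sum _ _ h7 h7 _ h
        · exact sum _ _ h7 h10 _ h
        · exact sum _ _ h9 h9 _ h
        · exact sum _ _ h9 h10 _ h
        · exact sum _ _ h10 h10 _ h
      · exact sum _ _ (gen (e + 6) (by omega)) (ih (n - (e + 6)) (by omega) (by omega)) n
          (by omega)

theorem minGens_closure_delta6_gens {e : ℕ} (he : 3 ≤ e) :
    minGens (AddSubmonoid.closure
        ({e + 6, e + 7, e + 9, e + 10} ∪ {x | e + 15 ≤ x ∧ x ≤ 2 * e + 11})) =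
      ({e + 6, e + 7, e + 9, e + 10} ∪ {x | e + 15 ≤ x ∧ x ≤ 2 * e + 11}) := by
  ext g
  rw [mem_delta6_gens_iff]
  simp only [minGens, Set.mem_ofPred_eq, mem_closure_delta6_gens_iff he]
  constructor
  · rintro ⟨hg, h0, h⟩
    by_contra hn
    by_cases h' : g = 2 * e + 14 ∨ 2 * e + 17 ≤ g ∧ g ≤ 2 * e + 20
    · have h1 := h (e + 7) (by omega) (e + 7) (by omega) (by omega) (by omega)
      have h2 := h (e + 7) (by omega) (e + 10) (by omega) (by omega) (by omega)
      have h3 := h (e + 9) (by omega) (e + 9) (by omega) (by omega) (by omega)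
      have h4 := h (e + 9) (by omega) (e + 10) (by omega) (by omega) (by omega)
      have h5 := h (e + 10) (by omega) (e + 10) (by omega) (by omega) (by omega)
      omega
    · exact h (e + 6) (by omega) (g - (e + 6)) (by omega) (by omega) (by omega) (by omega)
  · intro hg
    refine ⟨by omega, by omega, ?_⟩
    intro a ha b hb ha0 hb0
    omega

theorem ncard_delta6_gens {e : ℕ} (he : 3 ≤ e) :
    ({e + 6, e + 7, e + 9, e + 10} ∪ {x | e + 15 ≤ x ∧ x ≤ 2 * e + 11} : Set ℕ).ncard =
      e + 1 := by
  have h : ({e + 6, e + 7, e + 9, e + 10} ∪ {x | e + 15 ≤ x ∧ x ≤ 2 * e + 11} : Set ℕ) =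
      (({e + 6, e + 7, e + 9, e + 10} ∪ Finset.Icc (e + 15) (2 * e + 11) : Finset ℕ) : Set ℕ) := by
    ext x
    simp [or_assoc]
  rw [h, Set.ncard_coe_finset, Finset.card_union_of_disjoint]
  · have : ({e + 6, e + 7, e + 9, e + 10} : Finset ℕ).card = 4 := by
      simp [Finset.card_insert_of_notMem]
    rw [this, Nat.card_Icc]
    omega
  · rw [Finset.disjoint_left]
    intro x hx hx'
    simp only [Finset.mem_insert, Finset.mem_singleton] at hx
    rw [Finset.mem_Icc] at hx'
    omega

theorem factorizationHom_single (Γ : AddSubmonoid ℕ) (g : minGens Γ) :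
    factorizationHom Γ (Finsupp.single g 1) = g := by
  simp [factorizationHom]

theorem exists_factorizationHom_eq {Γ : AddSubmonoid ℕ} (hΓ : AddSubmonoid.closure (minGens Γ) = Γ)
    {t : ℕ} (ht : t ∈ Γ) : ∃ b, factorizationHom Γ b = t := by
  rw [← hΓ] at ht
  have hle : AddSubmonoid.closure (minGens Γ) ≤ AddMonoidHom.mrange (factorizationHom Γ) := by
    rw [AddSubmonoid.closure_le]
    intro g hg
    exact ⟨Finsupp.single ⟨g, hg⟩ 1, factorizationHom_single Γ ⟨g, hg⟩⟩
  exact hle ht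

theorem rho_closure_delta6_gens {e : ℕ} (he : 3 ≤ e) :
    rho (AddSubmonoid.closure
        ({e + 6, e + 7, e + 9, e + 10} ∪ {x | e + 15 ≤ x ∧ x ≤ 2 * e + 11})) =
      Nat.choose (e + 1) 2 + 2 := by
  have hmin := minGens_closure_delta6_gens he
  have hmemΓ := mem_closure_delta6_gens_iff he
  have hcard := ncard_delta6_gens he
  have hclo := congrArg AddSubmonoid.closure hmin
  have hmem := mem_delta6_gens_iff e
  rw [← hmin] at hcard hmem
  generalize AddSubmonoid.closure
    ({e + 6, e + 7, e + 9, e + 10} ∪ {x | e + 15 ≤ x ∧ x ≤ 2 * e + 11}) = Γ at *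
  have hfin : (minGens Γ).Finite := Set.finite_of_ncard_ne_zero (by omega)
  let := hfin.fintype
  have hc : Fintype.card (minGens Γ) = e + 1 := by
    rw [← hcard, ← Nat.card_coe_set_eq, Nat.card_eq_fintype_card]
  have hval := factorizationHom_single Γ
  have H : HasDelta6Values (factorizationHom Γ) (e + 6) ⟨e + 6, (hmem _).2 (by omega)⟩
      ⟨e + 7, (hmem _).2 (by omega)⟩ ⟨e + 9, (hmem _).2 (by omega)⟩
      ⟨e + 10, (hmem _).2 (by omega)⟩ :=
    { nine_le := by omega
      val0 := hval _
      val1 := hval _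
      val3 := hval _
      val4 := hval _
      inj := fun x y h => by
        rw [hval, hval] at h
        exact Subtype.ext h
      mem := fun x => by
        have := (hmem x).1 x.2
        rw [hval]
        omega
      lt := fun x => by
        have := (hmem x).1 x.2
        rw [hval]
        omega
      surj := fun t ht => exists_factorizationHom_eq hclo ((hmemΓ t).2 (by omega)) }
  have := H.sInf_ncard_eq
  rwa [hc] at this

/-- The monoid ⟨e+6, e+7, e+9, e+10, e+15, …, 2e+11⟩ is a numerical monoid with
multiplicity e+6, minimal generators as listed, embedding dimension e+1, and
ρ = C(e+1,2) + 2. -/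
theorem rho_example_delta6 (e : ℕ) (he : 3 ≤ e) :
    IsNumericalMonoid (AddSubmonoid.closure
        ({e + 6, e + 7, e + 9, e + 10} ∪ {x | e + 15 ≤ x ∧ x ≤ 2 * e + 11})) ∧
    mult (AddSubmonoid.closure
        ({e + 6, e + 7, e + 9, e + 10} ∪ {x | e + 15 ≤ x ∧ x ≤ 2 * e + 11})) = e + 6 ∧
    minGens (AddSubmonoid.closure
        ({e + 6, e + 7, e + 9, e + 10} ∪ {x | e + 15 ≤ x ∧ x ≤ 2 * e + 11})) =
      ({e + 6, e + 7, e + 9, e + 10} ∪ {x | e + 15 ≤ x ∧ x ≤ 2 * e + 11}) ∧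
    edim (AddSubmonoid.closure
        ({e + 6, e + 7, e + 9, e + 10} ∪ {x | e + 15 ≤ x ∧ x ≤ 2 * e + 11})) = e + 1 ∧
    rho (AddSubmonoid.closure
        ({e + 6, e + 7, e + 9, e + 10} ∪ {x | e + 15 ≤ x ∧ x ≤ 2 * e + 11})) =
      Nat.choose (e + 1) 2 + 2 := by
  have hmemΓ := mem_closure_delta6_gens_iff he
  refine ⟨?_, ?_, minGens_closure_delta6_gens he, ?_, rho_closure_delta6_gens he⟩
  · refine (Set.finite_lt_nat (e + 15)).subset fun n hn => ?_
    by_contra h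
    rw [Set.mem_ofPred_eq, not_lt] at h
    exact hn ((hmemΓ n).2 (by omega))
  · refine le_antisymm (Nat.sInf_le ⟨(hmemΓ _).2 (by omega), by omega⟩)
      (le_csInf ⟨e + 6, (hmemΓ _).2 (by omega), by omega⟩ ?_)
    rintro g ⟨hg, h0⟩
    have := (hmemΓ g).1 hg
    omega
  · rw [edim, minGens_closure_delta6_gens he, ncard_delta6_gens he]
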